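/- Let 𝔽 be a field of characteristic 0, let n ≥ 3, and let 𝔮 = (q_{ij}) be a multiplicatively antisymmetric n×n matrix over 𝔽 such that for every i there exists j with q_{ij} ≠ 1, and such that Λ_i is empty for every i (i.e. E = 0). Then every 𝔽-algebra automorphism σ of the quantum affine space 𝒪_𝔮 is linear, that is, for every i the element σ(X_i) lies in the 𝔽-linear span of X_1,…,X_n. -/

import Mathlib

/-- The defining relations of the multiparameter quantum affine space:
`X i * X j = q i j • (X j * X i)` for `i < j`. -/
inductive QuantumRel (F : Type*) [Field F] (n : ℕ) (q : Fin n → Fin n → F) :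
    FreeAlgebra F (Fin n) → FreeAlgebra F (Fin n) → Prop
  | rel (i j : Fin n) (h : i < j) :
      QuantumRel F n q (FreeAlgebra.ι F i * FreeAlgebra.ι F j)
        (q i j • (FreeAlgebra.ι F j * FreeAlgebra.ι F i))

/-- The multiparameter quantum affine space `𝒪_𝔮`. -/
abbrev QuantumAffineSpace (F : Type*) [Field F] (n : ℕ) (q : Fin n → Fin n → F) :=
  RingQuot (QuantumRel F n q)

/-- The canonical generators `X i` of the quantum affine space. -/
noncomputable def QX (F : Type*) [Field F] (n : ℕ) (q : Fin n → Fin n → F) (i : Fin n) :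
    QuantumAffineSpace F n q :=
  RingQuot.mkAlgHom F (QuantumRel F n q) (FreeAlgebra.ι F i)

/-- A multiplicatively antisymmetric matrix: nonzero entries, `q i i = 1`, `q j i = (q i j)⁻¹`. -/
def MultAntisym (F : Type*) [Field F] {n : ℕ} (q : Fin n → Fin n → F) : Prop :=
  (∀ i j, q i j ≠ 0) ∧ (∀ i, q i i = 1) ∧ (∀ i j, q j i = (q i j)⁻¹)

/-- An `F`-algebra automorphism of the quantum affine space is scalar if it sends each
generator `X i` to a nonzero scalar multiple of itself. -/
def IsScalarAut (F : Type*) [Field F] (n : ℕ) (q : Fin n → Fin n → F)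
    (σ : QuantumAffineSpace F n q ≃ₐ[F] QuantumAffineSpace F n q) : Prop :=
  ∃ a : Fin n → F, (∀ i, a i ≠ 0) ∧ ∀ i, σ (QX F n q i) = a i • QX F n q i

/-- `E = 0`: each set `Λ_i` is empty. -/
def LambdaEmpty (F : Type*) [Field F] {n : ℕ} (q : Fin n → Fin n → F) : Prop :=
  ∀ i : Fin n, ∀ ν : Fin n → ℕ,
    ¬ (ν i = 0 ∧ ∀ j, j ≠ i → (∏ k, q k j ^ ν k) = q i j)

/-- The `λ`-group: the subgroup of `Fˣ` generated by the multiparameters `q i j`, `i < j`. -/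
def lambdaGroup (F : Type*) [Field F] {n : ℕ} (q : Fin n → Fin n → F) : Subgroup Fˣ :=
  Subgroup.closure {u : Fˣ | ∃ i j : Fin n, i < j ∧ (u : F) = q i j}

namespace QuantumAffineSpace

variable {F : Type*} [Field F] {n : ℕ} {q : Fin n → Fin n → F}

theorem X_mul_X (hq : MultAntisym F q) (i j : Fin n) :
    QX F n q i * QX F n q j = q i j • (QX F n q j * QX F n q i) := by
  have key : ∀ i j : Fin n, i < j →
      QX F n q i * QX F n q j = q i j • (QX F n q j * QX F n q i) := fun i j h => by
    have := RingQuot.mkAlgHom_rel F (QuantumRel.rel (F := F) (q := q) i j h)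
    simpa [QX] using this
  rcases lt_trichotomy i j with h | rfl | h
  · exact key i j h
  · rw [hq.2.1, one_smul]
  · rw [key j i h, smul_smul, hq.2.2 j i, inv_mul_cancel₀ (hq.1 j i), one_smul]

theorem adjoin_range_X : Algebra.adjoin F (Set.range (QX F n q)) = ⊤ := by
  have h := congrArg (Subalgebra.map (RingQuot.mkAlgHom F (QuantumRel F n q)))
    (FreeAlgebra.adjoin_range_ι F (Fin n))
  rw [AlgHom.map_adjoin, ← Set.range_comp, Algebra.map_top,
    (AlgHom.range_eq_top _).2 (RingQuot.mkAlgHom_surjective F _)] at h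
  exact h

/-- Induction principle: the algebra is generated by the `X i`. -/
theorem induction_on {p : QuantumAffineSpace F n q → Prop} (f : QuantumAffineSpace F n q)
    (X : ∀ i, p (QX F n q i)) (scalar : ∀ r : F, p (algebraMap F _ r))
    (add : ∀ f g, p f → p g → p (f + g)) (mul : ∀ f g, p f → p g → p (f * g)) : p f := by
  have hf : f ∈ Algebra.adjoin F (Set.range (QX F n q)) := by
    rw [adjoin_range_X]; exact Algebra.mem_top
  induction hf using Algebra.adjoin_induction with
  | mem x hx => obtain ⟨i, rfl⟩ := hx; exact X i
  | algebraMap r => exact scalar r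
  | add x y _ _ hx hy => exact add x y hx hy
  | mul x y _ _ hx hy => exact mul x y hx hy

/-- The algebra homomorphism determined by a family of elements satisfying the relations. -/
theorem exists_algHom {B : Type*} [Ring B] [Algebra F B] (x : Fin n → B)
    (hx : ∀ i j, i < j → x i * x j = q i j • (x j * x i)) :
    ∃ φ : QuantumAffineSpace F n q →ₐ[F] B, ∀ i, φ (QX F n q i) = x i := by
  refine ⟨RingQuot.liftAlgHom F ⟨FreeAlgebra.lift F x, ?_⟩, fun i => ?_⟩
  · rintro _ _ ⟨i, j, h⟩
    simpa using hx i j h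
  · rw [QX, RingQuot.liftAlgHom_mkAlgHom_apply, FreeAlgebra.lift_ι_apply]

theorem algHom_ext {B : Type*} [Ring B] [Algebra F B] {φ ψ : QuantumAffineSpace F n q →ₐ[F] B}
    (h : ∀ i, φ (QX F n q i) = ψ (QX F n q i)) : φ = ψ := by
  refine AlgHom.ext_of_adjoin_eq_top adjoin_range_X ?_
  rintro _ ⟨i, rfl⟩
  exact h i

/-- The product of the generators along a list of indices. -/
noncomputable def word (q : Fin n → Fin n → F) (l : List (Fin n)) : QuantumAffineSpace F n q :=
  (l.map (QX F n q)).prod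

@[simp] theorem word_nil : word q [] = 1 := rfl

@[simp] theorem word_cons (i : Fin n) (l : List (Fin n)) :
    word q (i :: l) = QX F n q i * word q l := by
  simp [word]

theorem word_append (l l' : List (Fin n)) : word q (l ++ l') = word q l * word q l' := by
  simp [word]

theorem word_perm (hq : MultAntisym F q) {l l' : List (Fin n)} (h : l.Perm l') :
    ∃ c : F, c ≠ 0 ∧ word q l = c • word q l' := by
  induction h with
  | nil => exact ⟨1, one_ne_zero, by simp⟩
  | cons i _ ih =>
    obtain ⟨c, hc, h⟩ := ih
    exact ⟨c, hc, by simp [h]⟩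
  | swap i j l =>
    refine ⟨q j i, hq.1 j i, ?_⟩
    simp only [word_cons]
    rw [← mul_assoc, X_mul_X hq j i, smul_mul_assoc, mul_assoc]
  | trans _ _ ih₁ ih₂ =>
    obtain ⟨c, hc, h⟩ := ih₁
    obtain ⟨d, hd, h'⟩ := ih₂
    exact ⟨c * d, mul_ne_zero hc hd, by rw [h, h', smul_smul]⟩

theorem word_mul_X (hq : MultAntisym F q) (l : List (Fin n)) (j : Fin n) :
    word q l * QX F n q j = (l.map (q · j)).prod • (QX F n q j * word q l) := by
  induction l with
  | nil => simp
  | cons i l ih =>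
    rw [word_cons, mul_assoc, ih, mul_smul_comm, ← mul_assoc, X_mul_X hq i j, smul_mul_assoc,
      smul_smul, mul_assoc, List.map_cons, List.prod_cons, mul_comm]

/-- The monomial with a given exponent vector. -/
noncomputable def monomial (q : Fin n → Fin n → F) (ν : Fin n →₀ ℕ) : QuantumAffineSpace F n q :=
  word q (Finsupp.toMultiset ν).toList

theorem word_eq_smul_monomial (hq : MultAntisym F q) (l : List (Fin n)) :
    ∃ c : F, c ≠ 0 ∧ word q l = c • monomial q (Multiset.toFinsupp (l : Multiset (Fin n))) := by
  refine word_perm hq ?_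
  rw [← Multiset.coe_eq_coe, Multiset.coe_toList, Multiset.toFinsupp_toMultiset]

theorem monomial_zero : monomial q 0 = 1 := by
  simp [monomial]

theorem monomial_single (i : Fin n) : monomial q (Finsupp.single i 1) = QX F n q i := by
  simp [monomial]

theorem monomial_mul_monomial (hq : MultAntisym F q) (μ ν : Fin n →₀ ℕ) :
    ∃ c : F, c ≠ 0 ∧ monomial q μ * monomial q ν = c • monomial q (μ + ν) := by
  rw [monomial, monomial, ← word_append]
  convert word_eq_smul_monomial hq _
  rw [← Multiset.coe_add, Multiset.coe_toList, Multiset.coe_toList, ← Finsupp.toMultiset_add,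
    Finsupp.toMultiset_toFinsupp]

theorem monomial_mul_X (hq : MultAntisym F q) (ν : Fin n →₀ ℕ) (j : Fin n) :
    monomial q ν * QX F n q j = (∏ k, q k j ^ ν k) • (QX F n q j * monomial q ν) := by
  rw [monomial, word_mul_X hq]
  congr 1
  rw [← Multiset.prod_coe, ← Multiset.map_coe, Multiset.coe_toList, Finsupp.toMultiset_map,
    Finsupp.prod_toMultiset, Finsupp.prod_mapDomain_index (by simp) (by intros; rw [pow_add]),
    Finsupp.prod_fintype _ _ (by simp)]

theorem span_monomial (hq : MultAntisym F q) :
    Submodule.span F (Set.range (monomial q)) = ⊤ := by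
  refine eq_top_iff.2 fun f _ => ?_
  induction f using induction_on with
  | X i => exact Submodule.subset_span ⟨_, monomial_single i⟩
  | scalar r =>
    rw [Algebra.algebraMap_eq_smul_one, ← monomial_zero]
    exact Submodule.smul_mem _ _ (Submodule.subset_span ⟨0, rfl⟩)
  | add f g hf hg => exact add_mem (hf trivial) (hg trivial)
  | mul f g hf hg =>
    have hfg := Submodule.mul_mem_mul (hf trivial) (hg trivial)
    rw [Submodule.span_mul_span] at hfg
    refine Submodule.span_le.2 ?_ hfg
    rintro _ ⟨_, ⟨μ, rfl⟩, _, ⟨ν, rfl⟩, rfl⟩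
    obtain ⟨c, -, h⟩ := monomial_mul_monomial hq μ ν
    simp only [h]
    exact Submodule.smul_mem _ _ (Submodule.subset_span ⟨_, rfl⟩)

/-- Left multiplication by `X i` on the space spanned by the ordered monomials. -/
noncomputable def leftMulX (q : Fin n → Fin n → F) (i : Fin n) :
    Module.End F ((Fin n →₀ ℕ) →₀ F) :=
  Finsupp.linearCombination F fun ν =>
    Finsupp.single (Finsupp.single i 1 + ν) (∏ k, if k < i then q i k ^ ν k else 1)

theorem leftMulX_single (i : Fin n) (ν : Fin n →₀ ℕ) (r : F) :
    leftMulX q i (Finsupp.single ν r) =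
      Finsupp.single (Finsupp.single i 1 + ν) (r * ∏ k, if k < i then q i k ^ ν k else 1) := by
  simp [leftMulX]

theorem leftMulX_mul_leftMulX (hq : MultAntisym F q) {i j : Fin n} (h : i < j) :
    leftMulX q i * leftMulX q j = q i j • (leftMulX q j * leftMulX q i) := by
  have key : ∀ (a b : Fin n) (ν : Fin n →₀ ℕ),
      (∏ k, if k < a then q a k ^ (Finsupp.single b 1 + ν : Fin n →₀ ℕ) k else 1) =
        (if b < a then q a b else 1) * ∏ k, if k < a then q a k ^ ν k else 1 := by
    intro a b ν
    have h1 : (if b < a then q a b else 1) =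
        ∏ k, if k < a then q a k ^ (Finsupp.single b 1 : Fin n →₀ ℕ) k else 1 := by
      rw [Finset.prod_eq_single b]
      · simp
      · intro k _ hk
        simp [Finsupp.single_eq_of_ne hk]
      · simp
    rw [h1, ← Finset.prod_mul_distrib]
    refine Finset.prod_congr rfl fun k _ => ?_
    split_ifs <;> simp [pow_add]
  refine Finsupp.lhom_ext fun ν r => ?_
  simp only [Module.End.mul_apply, LinearMap.smul_apply, leftMulX_single, key, h, h.not_gt,
    if_true, if_false, Finsupp.smul_single, smul_eq_mul]
  rw [add_left_comm]
  congr 1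
  rw [hq.2.2 i j]
  field_simp [hq.1 i j]

theorem linearIndependent_monomial (hq : MultAntisym F q) :
    LinearIndependent F (monomial q) := by
  obtain ⟨ρ, hρ⟩ := exists_algHom (q := q) (leftMulX q) fun i j h => leftMulX_mul_leftMulX hq h
  have hw : ∀ l : List (Fin n), ∃ c : Fˣ, ρ (word q l) (Finsupp.single 0 1) =
      c • Finsupp.single (Multiset.toFinsupp (l : Multiset (Fin n))) (1 : F) := by
    intro l
    induction l with
    | nil => exact ⟨1, by simp⟩
    | cons i l ih =>
      obtain ⟨c, hc⟩ := ih
      refine ⟨c * Units.mk0 (∏ k, if k < i then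
        q i k ^ (Multiset.toFinsupp (l : Multiset (Fin n))) k else 1) ?_, ?_⟩
      · refine Finset.prod_ne_zero_iff.2 fun k _ => ?_
        split_ifs
        exacts [pow_ne_zero _ (hq.1 i k), one_ne_zero]
      · rw [word_cons, map_mul, hρ, Module.End.mul_apply, hc, Units.smul_def, map_smul,
          leftMulX_single, ← Multiset.cons_coe, ← Multiset.singleton_add,
          Multiset.toFinsupp_add, Multiset.toFinsupp_singleton, Units.smul_def]
        simp
  choose c hc using hw
  refine LinearIndependent.of_comp
    ((LinearMap.applyₗ (Finsupp.single 0 1 : (Fin n →₀ ℕ) →₀ F)).comp ρ.toLinearMap) ?_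
  convert (Finsupp.basisSingleOne (R := F) (ι := Fin n →₀ ℕ)).linearIndependent.units_smul
    (fun ν => c (Finsupp.toMultiset ν).toList) using 1
  ext1 ν
  simp only [Function.comp_apply, LinearMap.comp_apply, AlgHom.toLinearMap_apply,
    LinearMap.applyₗ_apply_apply, monomial, hc, Pi.smul_apply', Multiset.coe_toList,
    Finsupp.toMultiset_toFinsupp, Finsupp.coe_basisSingleOne]

/-- The monomial basis. -/
noncomputable def basis (hq : MultAntisym F q) :
    Module.Basis (Fin n →₀ ℕ) F (QuantumAffineSpace F n q) :=
  Module.Basis.mk (linearIndependent_monomial hq) (span_monomial hq).ge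

theorem basis_apply (hq : MultAntisym F q) (ν : Fin n →₀ ℕ) : basis hq ν = monomial q ν :=
  Module.Basis.mk_apply _ _ _

theorem basis_zero (hq : MultAntisym F q) : basis hq 0 = 1 := by
  rw [basis_apply, monomial_zero]

theorem basis_single (hq : MultAntisym F q) (i : Fin n) :
    basis hq (Finsupp.single i 1) = QX F n q i := by
  rw [basis_apply, monomial_single]

theorem repr_one (hq : MultAntisym F q) :
    (basis hq).repr 1 = Finsupp.single 0 1 := by
  rw [← basis_zero hq, Module.Basis.repr_self]

theorem repr_X (hq : MultAntisym F q) (i : Fin n) :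
    (basis hq).repr (QX F n q i) = Finsupp.single (Finsupp.single i 1) 1 := by
  rw [← basis_single hq, Module.Basis.repr_self]

/-- The structure constants of the monomial basis. -/
noncomputable def mulCoeff (hq : MultAntisym F q) (μ ν : Fin n →₀ ℕ) : F :=
  (basis hq).repr (basis hq μ * basis hq ν) (μ + ν)

theorem basis_mul_basis (hq : MultAntisym F q) (μ ν : Fin n →₀ ℕ) :
    basis hq μ * basis hq ν = mulCoeff hq μ ν • basis hq (μ + ν) := by
  obtain ⟨c, -, h⟩ := monomial_mul_monomial hq μ ν
  simp only [← basis_apply hq] at h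
  simp [mulCoeff, h]

theorem mulCoeff_ne_zero (hq : MultAntisym F q) (μ ν : Fin n →₀ ℕ) : mulCoeff hq μ ν ≠ 0 := by
  obtain ⟨c, hc, h⟩ := monomial_mul_monomial hq μ ν
  simp only [← basis_apply hq] at h
  simpa [mulCoeff, h] using hc

@[simp] theorem mulCoeff_zero_left (hq : MultAntisym F q) (ν : Fin n →₀ ℕ) :
    mulCoeff hq 0 ν = 1 := by
  simp [mulCoeff, basis_zero]

@[simp] theorem mulCoeff_zero_right (hq : MultAntisym F q) (ν : Fin n →₀ ℕ) :
    mulCoeff hq ν 0 = 1 := by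
  simp [mulCoeff, basis_zero]

theorem mulCoeff_single_right (hq : MultAntisym F q) (ν : Fin n →₀ ℕ) (j : Fin n) :
    mulCoeff hq ν (Finsupp.single j 1) =
      (∏ k, q k j ^ ν k) * mulCoeff hq (Finsupp.single j 1) ν := by
  have h := monomial_mul_X hq ν j
  rw [← basis_single hq, ← basis_apply hq] at h
  rw [mulCoeff, h, mulCoeff, add_comm, map_smul, Finsupp.smul_apply, smul_eq_mul]

theorem repr_mul (hq : MultAntisym F q) (f g : QuantumAffineSpace F n q) (ν : Fin n →₀ ℕ) :
    (basis hq).repr (f * g) ν = ∑ p ∈ Finset.HasAntidiagonal.antidiagonal ν,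
      mulCoeff hq p.1 p.2 * (basis hq).repr f p.1 * (basis hq).repr g p.2 := by
  induction (basis hq).mem_span f using Submodule.span_induction with
  | zero => simp
  | add f f' _ _ hf hf' =>
    simp [add_mul, mul_add, Finset.sum_add_distrib, hf, hf']
  | smul r f _ hf =>
    simp only [smul_mul_assoc, map_smul, Finsupp.smul_apply, hf, smul_eq_mul, Finset.mul_sum]
    exact Finset.sum_congr rfl fun _ _ => by ring
  | mem f hf =>
    obtain ⟨μ, rfl⟩ := hf
    induction (basis hq).mem_span g using Submodule.span_induction with
    | zero => simp
    | add f f' _ _ hf hf' =>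
      simp [mul_add, Finset.sum_add_distrib, hf, hf']
    | smul r f _ hf =>
      simp only [mul_smul_comm, map_smul, Finsupp.smul_apply, hf, smul_eq_mul, Finset.mul_sum]
      exact Finset.sum_congr rfl fun _ _ => by ring
    | mem g hg =>
      obtain ⟨κ, rfl⟩ := hg
      simp only [basis_mul_basis, map_smul, Module.Basis.repr_self, Finsupp.smul_apply]
      rw [Finset.sum_congr rfl (g := fun p : (Fin n →₀ ℕ) × (Fin n →₀ ℕ) =>
        if (μ, κ) = p then mulCoeff hq μ κ else 0), Finset.sum_ite_eq]
      · simp [Finsupp.single_apply]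
      · rintro ⟨a, b⟩ -
        by_cases ha : μ = a <;> by_cases hb : κ = b <;> simp [ha, hb]

theorem repr_mul_of_uniqueAdd (hq : MultAntisym F q) {f g : QuantumAffineSpace F n q}
    {a b : Fin n →₀ ℕ}
    (h : UniqueAdd ((basis hq).repr f).support ((basis hq).repr g).support a b) :
    (basis hq).repr (f * g) (a + b) =
      mulCoeff hq a b * (basis hq).repr f a * (basis hq).repr g b := by
  rw [repr_mul, Finset.sum_eq_single (a, b)]
  · rintro ⟨c, d⟩ hcd hne
    by_contra h0
    rw [← Ne, mul_ne_zero_iff, mul_ne_zero_iff] at h0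
    obtain ⟨rfl, rfl⟩ := h (Finsupp.mem_support_iff.2 h0.1.2) (Finsupp.mem_support_iff.2 h0.2)
      (Finset.HasAntidiagonal.mem_antidiagonal.1 hcd)
    exact hne rfl
  · intro hne
    simp at hne

theorem exists_eq_algebraMap_of_mul_eq_one (hq : MultAntisym F q)
    {v w : QuantumAffineSpace F n q} (h : v * w = 1) :
    ∃ r : F, v = algebraMap F _ r := by
  have : Nontrivial (QuantumAffineSpace F n q) := (basis hq).repr.toEquiv.nontrivial
  set A := ((basis hq).repr v).support with hA
  set B := ((basis hq).repr w).support with hB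
  have key : ∀ a ∈ A, ∀ b ∈ B, UniqueAdd A B a b → a + b = 0 := by
    intro a ha b hb hab
    have h1 := repr_mul_of_uniqueAdd hq hab
    rw [h, repr_one] at h1
    by_contra hne
    rw [Finsupp.single_eq_of_ne hne] at h1
    exact mul_ne_zero (mul_ne_zero (mulCoeff_ne_zero hq a b) (Finsupp.mem_support_iff.1 ha))
      (Finsupp.mem_support_iff.1 hb) h1.symm
  have hAne : A.Nonempty := by
    rw [hA, Finsupp.support_nonempty_iff, Ne, EmbeddingLike.map_eq_zero_iff]
    rintro rfl
    simp at h
  have hBne : B.Nonempty := by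
    rw [hB, Finsupp.support_nonempty_iff, Ne, EmbeddingLike.map_eq_zero_iff]
    rintro rfl
    simp at h
  have hcard : A.card * B.card ≤ 1 := by
    by_contra! hlt
    obtain ⟨p, hp, p', hp', hne, hu, hu'⟩ := TwoUniqueSums.uniqueAdd_of_one_lt_card hlt
    rw [Finset.mem_product] at hp hp'
    have hsum := (key _ hp.1 _ hp.2 hu).trans (key _ hp'.1 _ hp'.2 hu').symm
    obtain ⟨h1, h2⟩ := hu' hp.1 hp.2 hsum
    exact hne (Prod.ext h1 h2)
  have hA1 : A.card = 1 := by
    have := hAne.card_pos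
    have := hBne.card_pos
    nlinarith
  have hB1 : B.card = 1 := by
    have := hBne.card_pos
    nlinarith
  obtain ⟨a, ha⟩ := Finset.card_eq_one.1 hA1
  obtain ⟨b, hb⟩ := Finset.card_eq_one.1 hB1
  have hab : a + b = 0 := key a (by simp [ha]) b (by simp [hb]) fun c d hc hd _ => by
    rw [ha, Finset.mem_singleton] at hc
    rw [hb, Finset.mem_singleton] at hd
    exact ⟨hc, hd⟩
  obtain ⟨rfl, rfl⟩ := add_eq_zero.1 hab
  refine ⟨(basis hq).repr v 0, (basis hq).repr.injective ?_⟩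
  rw [Algebra.algebraMap_eq_smul_one, map_smul, repr_one, Finsupp.smul_single, smul_eq_mul, mul_one]
  exact Finsupp.eq_single_iff.2 ⟨ha.subset, rfl⟩

theorem X_mul_injective (hq : MultAntisym F q) (i : Fin n) :
    Function.Injective (QX F n q i * ·) := by
  intro f g hfg
  refine (basis hq).repr.injective (Finsupp.ext fun ν => ?_)
  have key : ∀ f : QuantumAffineSpace F n q, (basis hq).repr (QX F n q i * f)
      (Finsupp.single i 1 + ν) = mulCoeff hq (Finsupp.single i 1) ν * (basis hq).repr f ν := by
    intro f
    rw [repr_mul_of_uniqueAdd, repr_X, Finsupp.single_eq_same, mul_one]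
    intro c d hc _ hcd
    rw [repr_X, Finsupp.support_single _ one_ne_zero, Finset.mem_singleton] at hc
    exact ⟨hc, add_left_cancel (hc ▸ hcd)⟩
  have h := key f
  simp only at hfg
  rw [hfg, key g] at h
  exact (mul_left_cancel₀ (mulCoeff_ne_zero hq _ _) h).symm

theorem exists_eq_X_mul (hq : MultAntisym F q) (i : Fin n) {f : QuantumAffineSpace F n q}
    (h : ∀ ν, (basis hq).repr f ν ≠ 0 → ν i ≠ 0) : ∃ u, f = QX F n q i * u := by
  suffices f ∈ LinearMap.range (LinearMap.mulLeft F (QX F n q i)) by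
    obtain ⟨u, hu⟩ := this
    exact ⟨u, hu.symm⟩
  rw [← (basis hq).linearCombination_repr f]
  refine Submodule.sum_mem _ fun ν hν => Submodule.smul_mem _ _ ?_
  have hle : Finsupp.single i 1 ≤ ν := by
    rw [Finsupp.single_le_iff]
    exact Nat.one_le_iff_ne_zero.2 (h ν (Finsupp.mem_support_iff.1 hν))
  obtain ⟨μ, rfl⟩ := exists_add_of_le hle
  refine ⟨(mulCoeff hq (Finsupp.single i 1) μ)⁻¹ • basis hq μ, ?_⟩
  rw [LinearMap.mulLeft_apply, mul_smul_comm, ← basis_single hq, basis_mul_basis, smul_smul,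
    inv_mul_cancel₀ (mulCoeff_ne_zero hq _ _), one_smul]

theorem repr_mul_zero (hq : MultAntisym F q) (f g : QuantumAffineSpace F n q) :
    (basis hq).repr (f * g) 0 = (basis hq).repr f 0 * (basis hq).repr g 0 := by
  simp [repr_mul]

theorem repr_mul_single (hq : MultAntisym F q) (f g : QuantumAffineSpace F n q) (l : Fin n) :
    (basis hq).repr (f * g) (Finsupp.single l 1) =
      (basis hq).repr f 0 * (basis hq).repr g (Finsupp.single l 1) +
        (basis hq).repr f (Finsupp.single l 1) * (basis hq).repr g 0 := by
  rw [repr_mul, Finsupp.antidiagonal_single, Finset.sum_map,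
    Finset.Nat.sum_antidiagonal_eq_sum_range_succ_mk]
  simp [Finset.sum_range_succ]

theorem repr_algebraMap (hq : MultAntisym F q) (r : F) :
    (basis hq).repr (algebraMap F (QuantumAffineSpace F n q) r) = Finsupp.single 0 r := by
  rw [Algebra.algebraMap_eq_smul_one, map_smul, repr_one, Finsupp.smul_single, smul_eq_mul, mul_one]

/-- The matrix of linear coefficients of the images of the generators. -/
noncomputable def linearPart (hq : MultAntisym F q)
    (φ : QuantumAffineSpace F n q →ₐ[F] QuantumAffineSpace F n q) : Matrix (Fin n) (Fin n) F :=
  fun i k => (basis hq).repr (φ (QX F n q i)) (Finsupp.single k 1)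

theorem repr_map_of_augmented (hq : MultAntisym F q)
    {φ : QuantumAffineSpace F n q →ₐ[F] QuantumAffineSpace F n q}
    (hφ : ∀ i, (basis hq).repr (φ (QX F n q i)) 0 = 0) (f : QuantumAffineSpace F n q) :
    (basis hq).repr (φ f) 0 = (basis hq).repr f 0 ∧
      ∀ l, (basis hq).repr (φ f) (Finsupp.single l 1) =
        ∑ k, (basis hq).repr f (Finsupp.single k 1) * linearPart hq φ k l := by
  induction f using induction_on with
  | X i =>
    simp [hφ, repr_X, linearPart, Finsupp.single_apply, Finsupp.single_left_inj]
  | scalar r =>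
    simp [repr_algebraMap]
  | add f g hf hg =>
    simp [hf, hg, add_mul, Finset.sum_add_distrib]
  | mul f g hf hg =>
    refine ⟨by simp [repr_mul_zero, hf, hg], fun l => ?_⟩
    rw [map_mul, repr_mul_single, hf.1, hf.2, hg.1, hg.2, Finset.mul_sum, Finset.sum_mul,
      ← Finset.sum_add_distrib]
    refine Finset.sum_congr rfl fun k _ => ?_
    rw [repr_mul_single]
    ring

theorem linearPart_comp (hq : MultAntisym F q)
    {φ : QuantumAffineSpace F n q →ₐ[F] QuantumAffineSpace F n q}
    (hφ : ∀ i, (basis hq).repr (φ (QX F n q i)) 0 = 0)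
    (ψ : QuantumAffineSpace F n q →ₐ[F] QuantumAffineSpace F n q) :
    linearPart hq (φ.comp ψ) = linearPart hq ψ * linearPart hq φ := by
  ext i l
  exact (repr_map_of_augmented hq hφ (ψ (QX F n q i))).2 l

theorem linearPart_id (hq : MultAntisym F q) : linearPart hq (AlgHom.id F _) = 1 := by
  ext i l
  simp [linearPart, repr_X, Finsupp.single_apply, Finsupp.single_left_inj, Matrix.one_apply]

theorem linearIndependent_linearPart (hq : MultAntisym F q)
    {φ : QuantumAffineSpace F n q →ₐ[F] QuantumAffineSpace F n q} (hφ : Function.Surjective φ) :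
    LinearIndependent F (linearPart hq φ) := by
  refine linearIndependent_of_top_le_span_of_card_eq_finrank ?_ (by simp)
  have key : ∀ f, (fun l => (basis hq).repr (φ f) (Finsupp.single l 1)) ∈
      Submodule.span F (Set.range (linearPart hq φ)) := by
    intro f
    induction f using induction_on with
    | X i => exact Submodule.subset_span ⟨i, rfl⟩
    | scalar r =>
      convert Submodule.zero_mem _ using 1
      ext l
      simp [repr_algebraMap]
    | add f g hf hg =>
      convert add_mem hf hg using 1
      ext l
      simp
    | mul f g hf hg =>
      convert add_mem (Submodule.smul_mem _ ((basis hq).repr (φ f) 0) hg)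
        (Submodule.smul_mem _ ((basis hq).repr (φ g) 0) hf) using 1
      ext l
      simp [repr_mul_single, mul_comm]
  rw [← (Pi.basisFun F (Fin n)).span_eq, Submodule.span_le]
  rintro _ ⟨k, rfl⟩
  obtain ⟨f, hf⟩ := hφ (QX F n q k)
  suffices h : Pi.basisFun F (Fin n) k =
      fun l => (basis hq).repr (φ f) (Finsupp.single l 1) from h ▸ key f
  ext l
  simp [hf, repr_X, Finsupp.single_apply, Finsupp.single_left_inj, Pi.single_apply, eq_comm]

theorem repr_map_X_zero (hq : MultAntisym F q) (hrow : ∀ i, ∃ j, q i j ≠ 1)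
    {φ : QuantumAffineSpace F n q →ₐ[F] QuantumAffineSpace F n q} (hφ : Function.Surjective φ)
    (i : Fin n) : (basis hq).repr (φ (QX F n q i)) 0 = 0 := by
  by_contra ha
  obtain ⟨j, hj⟩ := hrow i
  have hrel := congrArg φ (X_mul_X hq i j)
  rw [map_mul, map_smul, map_mul] at hrel
  have hb : (basis hq).repr (φ (QX F n q j)) 0 = 0 := by
    have h0 := congrArg (fun f => (basis hq).repr f 0) hrel
    simp only [map_smul, Finsupp.smul_apply, smul_eq_mul, repr_mul_zero] at h0
    have : (1 - q i j) * (basis hq).repr (φ (QX F n q i)) 0 *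
      (basis hq).repr (φ (QX F n q j)) 0 = 0 := by linear_combination h0
    simpa [sub_eq_zero, hj.symm, ha] using this
  refine (linearIndependent_linearPart hq hφ).ne_zero j (funext fun l => ?_)
  have hl := congrArg (fun f => (basis hq).repr f (Finsupp.single l 1)) hrel
  simp only [map_smul, Finsupp.smul_apply, smul_eq_mul, repr_mul_single, hb] at hl
  have : (1 - q i j) * (basis hq).repr (φ (QX F n q i)) 0 *
    (basis hq).repr (φ (QX F n q j)) (Finsupp.single l 1) = 0 := by linear_combination hl
  simpa [sub_eq_zero, hj.symm, ha, linearPart] using this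

theorem exists_eq_single_of_degree_eq_one {ν : Fin n →₀ ℕ} (h : ν.degree = 1) :
    ∃ k, ν = Finsupp.single k 1 := by
  obtain ⟨k, hk⟩ : ∃ k, ν k ≠ 0 := by
    by_contra! h0
    obtain rfl : ν = 0 := Finsupp.ext h0
    simp at h
  obtain ⟨μ, rfl⟩ := exists_add_of_le (Finsupp.single_le_iff.2 (Nat.one_le_iff_ne_zero.2 hk))
  rw [map_add, Finsupp.degree_single, add_eq_left, Finsupp.degree_eq_zero_iff] at h
  exact ⟨k, by rw [h, add_zero]⟩

/-- An endomorphism preserving the augmentation has a linear part which is an endomorphism. -/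
theorem exists_linear_algHom (hq : MultAntisym F q)
    {φ : QuantumAffineSpace F n q →ₐ[F] QuantumAffineSpace F n q}
    (hφ : ∀ i, (basis hq).repr (φ (QX F n q i)) 0 = 0) :
    ∃ φ₁ : QuantumAffineSpace F n q →ₐ[F] QuantumAffineSpace F n q,
      ∀ i, φ₁ (QX F n q i) = ∑ k, linearPart hq φ i k • QX F n q k := by
  refine exists_algHom _ fun i j _ => ?_
  have hlin : ∀ i ν, (basis hq).repr (∑ k, linearPart hq φ i k • QX F n q k) ν =
      if ν.degree = 1 then (basis hq).repr (φ (QX F n q i)) ν else 0 := by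
    intro i ν
    simp only [map_sum, map_smul, repr_X, Finsupp.finsetSum_apply, Finsupp.smul_apply,
      smul_eq_mul]
    split_ifs with hν
    · obtain ⟨l, rfl⟩ := exists_eq_single_of_degree_eq_one hν
      simp [Finsupp.single_apply, Finsupp.single_left_inj, linearPart]
    · refine Finset.sum_eq_zero fun k _ => ?_
      rw [Finsupp.single_eq_of_ne, mul_zero]
      rintro rfl
      simp at hν
  have hmul : ∀ i j ν, (basis hq).repr ((∑ k, linearPart hq φ i k • QX F n q k) *
      ∑ k, linearPart hq φ j k • QX F n q k) ν =
      if ν.degree = 2 then (basis hq).repr (φ (QX F n q i) * φ (QX F n q j)) ν else 0 := by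
    intro i j ν
    rw [repr_mul, repr_mul, Finset.sum_congr rfl (g := fun p => if ν.degree = 2 then
      mulCoeff hq p.1 p.2 * (basis hq).repr (φ (QX F n q i)) p.1 *
        (basis hq).repr (φ (QX F n q j)) p.2 else 0)]
    · split_ifs <;> simp
    intro p hp
    have hdeg := congrArg Finsupp.degree (Finset.HasAntidiagonal.mem_antidiagonal.1 hp)
    rw [map_add] at hdeg
    rw [hlin, hlin]
    have h0 : ∀ i (μ : Fin n →₀ ℕ), μ.degree = 0 → (basis hq).repr (φ (QX F n q i)) μ = 0 := by
      intro i μ hμ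
      rw [Finsupp.degree_eq_zero_iff] at hμ
      rw [hμ, hφ]
    rcases Nat.lt_trichotomy p.1.degree 1 with h1 | h1 | h1
    · simp [h0 i p.1 (by omega)]
    · by_cases h2 : p.2.degree = 1
      · simp [h1, h2, show ν.degree = 2 by omega]
      · simp [h2, show ν.degree ≠ 2 by omega]
    · by_cases h2 : p.2.degree = 0
      · simp [h0 j p.2 h2]
      · simp [show ν.degree ≠ 2 by omega, h1.ne']
  refine (basis hq).repr.injective (Finsupp.ext fun ν => ?_)
  rw [map_smul, Finsupp.smul_apply, hmul, hmul, ← map_mul, X_mul_X hq, map_smul, map_smul,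
    ← map_mul, Finsupp.smul_apply, smul_ite, smul_zero]

/-- Under `E = 0`, an endomorphism tangent to the identity preserves each right ideal
generated by an `X i`. -/
theorem exists_map_X_eq_X_mul (hq : MultAntisym F q) (hE : LambdaEmpty F q)
    {τ : QuantumAffineSpace F n q →ₐ[F] QuantumAffineSpace F n q}
    (h0 : ∀ i, (basis hq).repr (τ (QX F n q i)) 0 = 0) (h1 : linearPart hq τ = 1) (i : Fin n) :
    ∃ u, τ (QX F n q i) = QX F n q i * u := by
  refine exists_eq_X_mul hq i ?_
  by_contra! hne
  obtain ⟨ν, ⟨hν, hνi⟩, hmin⟩ := exists_minimalFor_of_wellFoundedLT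
    (fun ν => (basis hq).repr (τ (QX F n q i)) ν ≠ 0 ∧ ν i = 0) Finsupp.degree hne
  refine hE i ν ⟨hνi, fun j hj => ?_⟩
  have hsupp : ∀ a b : Fin n →₀ ℕ, (basis hq).repr (τ (QX F n q i)) a ≠ 0 →
      (basis hq).repr (τ (QX F n q j)) b ≠ 0 → a + b = ν + Finsupp.single j 1 →
      a = ν ∧ b = Finsupp.single j 1 := by
    intro a b ha hb hab
    have hai : a i = 0 := by
      have := DFunLike.congr_fun hab i
      simp [hνi, Finsupp.single_eq_of_ne hj.symm] at this
      exact this.1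
    have hdeg := congrArg Finsupp.degree hab
    rw [map_add, map_add, Finsupp.degree_single] at hdeg
    have hdb : b.degree ≠ 0 := fun h => hb (by rw [(Finsupp.degree_eq_zero_iff b).1 h, h0])
    have hda : ν.degree ≤ a.degree := by
      by_contra! hlt
      exact absurd (hmin ⟨ha, hai⟩ hlt.le) (not_le.2 hlt)
    obtain ⟨k, rfl⟩ := exists_eq_single_of_degree_eq_one (show b.degree = 1 by omega)
    have hjk : j = k := by
      by_contra hjk
      have := congrFun (congrFun h1 j) k
      rw [Matrix.one_apply_ne hjk] at this
      exact hb this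
    subst hjk
    exact ⟨add_right_cancel hab, rfl⟩
  have hrel := congrArg (fun f => (basis hq).repr (τ f) (ν + Finsupp.single j 1)) (X_mul_X hq i j)
  simp only [map_smul, map_mul, Finsupp.smul_apply, smul_eq_mul] at hrel
  have hjj : (basis hq).repr (τ (QX F n q j)) (Finsupp.single j 1) = 1 := by
    have := congrFun (congrFun h1 j) j
    rwa [Matrix.one_apply_eq] at this
  rw [repr_mul_of_uniqueAdd hq (fun a b ha hb hab => hsupp a b (Finsupp.mem_support_iff.1 ha)
      (Finsupp.mem_support_iff.1 hb) hab), add_comm ν,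
    repr_mul_of_uniqueAdd hq (fun a b ha hb hab => (hsupp b a (Finsupp.mem_support_iff.1 hb)
      (Finsupp.mem_support_iff.1 ha) (by rw [add_comm, hab, add_comm])).symm), hjj,
    mulCoeff_single_right] at hrel
  refine mul_right_cancel₀ (mul_ne_zero (mulCoeff_ne_zero hq (Finsupp.single j 1) ν) hν) ?_
  linear_combination hrel

/-- Under `E = 0`, an endomorphism tangent to the identity with a left inverse tangent to the
identity is trivial. -/
theorem eq_id_of_linearPart_eq_one (hq : MultAntisym F q) (hE : LambdaEmpty F q)
    {τ τ' : QuantumAffineSpace F n q →ₐ[F] QuantumAffineSpace F n q}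
    (hτ0 : ∀ i, (basis hq).repr (τ (QX F n q i)) 0 = 0) (hτ1 : linearPart hq τ = 1)
    (hτ0' : ∀ i, (basis hq).repr (τ' (QX F n q i)) 0 = 0) (hτ1' : linearPart hq τ' = 1)
    (h : τ'.comp τ = AlgHom.id F _) : τ' = AlgHom.id F _ := by
  refine algHom_ext fun i => ?_
  obtain ⟨u, hu⟩ := exists_map_X_eq_X_mul hq hE hτ0 hτ1 i
  obtain ⟨v, hv⟩ := exists_map_X_eq_X_mul hq hE hτ0' hτ1' i
  have hX := DFunLike.congr_fun h (QX F n q i)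
  rw [AlgHom.comp_apply, hu, map_mul, hv, mul_assoc, AlgHom.id_apply] at hX
  obtain ⟨r, rfl⟩ := exists_eq_algebraMap_of_mul_eq_one hq
    (X_mul_injective hq i (hX.trans (mul_one _).symm))
  have hr := congrFun (congrFun hτ1' i) i
  rw [← Algebra.commutes, ← Algebra.smul_def] at hv
  rw [Matrix.one_apply_eq, linearPart, hv, map_smul, repr_X, Finsupp.smul_apply,
    Finsupp.single_eq_same, smul_eq_mul, mul_one] at hr
  rw [hv, hr, one_smul, AlgHom.id_apply]

end QuantumAffineSpace

open QuantumAffineSpace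

theorem aut_is_linear_of_E_eq_zero (F : Type*) [Field F] [CharZero F]
    (n : ℕ) (hn : 3 ≤ n) (q : Fin n → Fin n → F) (hq : MultAntisym F q)
    (hrow : ∀ i : Fin n, ∃ j : Fin n, q i j ≠ 1)
    (hE : LambdaEmpty F q)
    (σ : QuantumAffineSpace F n q ≃ₐ[F] QuantumAffineSpace F n q) :
    ∀ i : Fin n, σ (QX F n q i) ∈ Submodule.span F (Set.range (QX F n q)) := by
  set f : QuantumAffineSpace F n q →ₐ[F] QuantumAffineSpace F n q := σ.toAlgHom with hf
  set g : QuantumAffineSpace F n q →ₐ[F] QuantumAffineSpace F n q := σ.symm.toAlgHom with hg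
  have hgf : g.comp f = AlgHom.id F _ := AlgHom.ext fun x => σ.symm_apply_apply x
  have hfg : f.comp g = AlgHom.id F _ := AlgHom.ext fun x => σ.apply_symm_apply x
  have hf0 := repr_map_X_zero hq hrow (φ := f) σ.surjective
  have hg0 := repr_map_X_zero hq hrow (φ := g) σ.symm.surjective
  have hMf : linearPart hq f * linearPart hq g = 1 := by
    rw [← linearPart_comp hq hg0, hgf, linearPart_id]
  have hMg : linearPart hq g * linearPart hq f = 1 := by
    rw [← linearPart_comp hq hf0, hfg, linearPart_id]
  obtain ⟨f₁, hf₁⟩ := exists_linear_algHom hq hf0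
  obtain ⟨g₁, hg₁⟩ := exists_linear_algHom hq hg0
  have hf₁0 : ∀ i, (basis hq).repr (f₁ (QX F n q i)) 0 = 0 := by simp [hf₁, repr_X]
  have hg₁0 : ∀ i, (basis hq).repr (g₁ (QX F n q i)) 0 = 0 := by simp [hg₁, repr_X]
  have hLf : linearPart hq f₁ = linearPart hq f := by
    ext i k
    rw [linearPart, hf₁]
    simp [repr_X, Finsupp.single_apply, Finsupp.single_left_inj]
  have hLg : linearPart hq g₁ = linearPart hq g := by
    ext i k
    rw [linearPart, hg₁]
    simp [repr_X, Finsupp.single_apply, Finsupp.single_left_inj]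
  have hfg₁ : f₁.comp g₁ = AlgHom.id F _ := by
    refine algHom_ext fun i => ?_
    have hM := fun l => congrFun (congrFun hMg i) l
    simp only [Matrix.mul_apply] at hM
    simp only [AlgHom.comp_apply, hg₁, map_sum, map_smul, hf₁, Finset.smul_sum, smul_smul]
    rw [Finset.sum_comm]
    simp [← Finset.sum_smul, hM, Matrix.one_apply]
  have hid : g.comp f₁ = AlgHom.id F _ := by
    refine eq_id_of_linearPart_eq_one hq hE (τ := g₁.comp f) ?_ ?_ ?_ ?_ ?_
    · intro i
      rw [AlgHom.comp_apply, (repr_map_of_augmented hq hg₁0 _).1, hf0]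
    · rw [linearPart_comp hq hg₁0, hLg, hMf]
    · intro i
      rw [AlgHom.comp_apply, (repr_map_of_augmented hq hg0 _).1, hf₁0]
    · rw [linearPart_comp hq hg0, hLf, hMf]
    · rw [AlgHom.comp_assoc, ← AlgHom.comp_assoc f₁, hfg₁, AlgHom.id_comp, hgf]
  intro i
  have hσ : σ (QX F n q i) = f₁ (QX F n q i) := by
    have h := DFunLike.congr_fun hid (QX F n q i)
    exact (σ.symm_apply_eq.1 h).symm
  rw [hσ, hf₁]
  exact Submodule.sum_mem _ fun k _ => Submodule.smul_mem _ _ (Submodule.subset_span ⟨k, rfl⟩)
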